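/- arXiv:2105.00747 — 2 statements merged into one kernel-verified Lean document; each statement's English description precedes it below -/
import Mathlib

section
/- Let p, q be integers with 0 ≤ p < q ≤ M and q − p ≥ 2√32, and set I′ = (pd, qd). Suppose γ > 0 and N_j/(N d) ≥ γ for every j with p+1 ≤ j ≤ q. Let u : [0,1] → ℝ be twice continuously differentiable and suppose the Sobolev interpolation inequality ∫_{I′} u′(x)² dx ≤ 32( ε⁻²·∫_{I′} u(x)² dx + ε²·∫_{I′} u″(x)² dx ) holds for every ε ∈ (0, (q−p)d]. Then ∫_{I′} u(x)² dx ≤ (4/(N γ))·Σ_{i=1}^N u(x_i)² + 16·32²·d⁴·∫_{I′} u″(x)² dx. -/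
open MeasureTheory Finset
open scoped Classical

/-- `histCount M N x j` is the number `N_j` of observation points among `x 1, …, x N`
that belong to the subinterval `I_j`, where `I_1 = [0, d]` and `I_j = ((j-1)d, jd]`
for `2 ≤ j ≤ M`, with mesh size `d = 1/M`. -/
noncomputable def histCount (M N : ℕ) (x : Fin N → ℝ) (j : ℕ) : ℕ :=
  (Finset.univ.filter (fun i : Fin N =>
    if j = 1 then x i ∈ Set.Icc (0 : ℝ) ((M : ℝ)⁻¹)
    else x i ∈ Set.Ioc (((j : ℝ) - 1) * (M : ℝ)⁻¹) ((j : ℝ) * (M : ℝ)⁻¹))).card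

/-- Cauchy–Schwarz on an interval: `(∫ f)² ≤ (b - a) ∫ f²` for continuous `f`. -/
theorem sq_intervalIntegral_le {f : ℝ → ℝ} {a b : ℝ} (hab : a ≤ b)
    (hf : ContinuousOn f (Set.Icc a b)) :
    (∫ t in a..b, f t) ^ 2 ≤ (b - a) * ∫ t in a..b, f t ^ 2 := by
  rcases hab.eq_or_lt with rfl | hlt
  · simp
  have hf' : ContinuousOn f (Set.uIcc a b) := by rwa [Set.uIcc_of_le hab]
  have hf1 : IntervalIntegrable f volume a b := hf'.intervalIntegrable
  have hf2 : IntervalIntegrable (fun t => f t ^ 2) volume a b := (hf'.pow 2).intervalIntegrable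
  set I := ∫ t in a..b, f t with hI
  have h0 : 0 ≤ ∫ t in a..b, ((b - a) * f t - I) ^ 2 :=
    intervalIntegral.integral_nonneg hab fun t _ => sq_nonneg _
  have h1 : ∫ t in a..b, ((b - a) * f t - I) ^ 2
      = (b - a) * ((b - a) * (∫ t in a..b, f t ^ 2) - I ^ 2) := by
    have he : (fun t => ((b - a) * f t - I) ^ 2)
        = fun t => ((b - a) ^ 2 * f t ^ 2 - (2 * (b - a) * I) * f t) + I ^ 2 := by
      funext t; ring
    rw [he, intervalIntegral.integral_add ((hf2.const_mul _).sub (hf1.const_mul _)) (by simp),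
      intervalIntegral.integral_sub (hf2.const_mul _) (hf1.const_mul _),
      intervalIntegral.integral_const_mul, intervalIntegral.integral_const_mul,
      intervalIntegral.integral_const, smul_eq_mul, ← hI]
    ring
  rw [h1] at h0
  linarith [nonneg_of_mul_nonneg_right h0 (sub_pos.2 hlt)]

/-- Increments of a `C¹` function on `[a, b]` are controlled by the `L²` norm of its derivative. -/
theorem sq_sub_le_mul_integral_sq_deriv {u u' : ℝ → ℝ} {a b s y : ℝ}
    (hu : ∀ t ∈ Set.Icc a b, HasDerivWithinAt u (u' t) (Set.Icc a b) t)
    (hu' : ContinuousOn u' (Set.Icc a b)) (hs : s ∈ Set.Icc a b) (hy : y ∈ Set.Icc a b)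
    (hsy : s ≤ y) :
    (u y - u s) ^ 2 ≤ (b - a) * ∫ t in a..b, u' t ^ 2 := by
  have hab : a ≤ b := hs.1.trans hs.2
  have hsub : Set.Icc s y ⊆ Set.Icc a b := Set.Icc_subset_Icc hs.1 hy.2
  have hc : ContinuousOn u' (Set.Icc s y) := hu'.mono hsub
  have hftc : ∫ t in s..y, u' t = u y - u s := by
    refine intervalIntegral.integral_eq_sub_of_hasDerivAt_of_le hsy
      (fun t ht => ((hu t (hsub ht)).continuousWithinAt).mono hsub) (fun t ht => ?_) ?_
    · exact (hu t (hsub (Set.Ioo_subset_Icc_self ht))).hasDerivAt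
        (Icc_mem_nhds (hs.1.trans_lt ht.1) (ht.2.trans_le hy.2))
    · exact ContinuousOn.intervalIntegrable (by rwa [Set.uIcc_of_le hsy])
  have hcs := sq_intervalIntegral_le hsy hc
  rw [hftc] at hcs
  have hmono : ∫ t in s..y, u' t ^ 2 ≤ ∫ t in a..b, u' t ^ 2 :=
    intervalIntegral.integral_mono_interval hs.1 hsy hy.2
      (Filter.Eventually.of_forall fun t => sq_nonneg _)
      (ContinuousOn.intervalIntegrable (by rw [Set.uIcc_of_le hab]; exact hu'.pow 2))
  have h0 : 0 ≤ ∫ t in s..y, u' t ^ 2 :=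
    intervalIntegral.integral_nonneg hsy fun t _ => sq_nonneg _
  exact hcs.trans (mul_le_mul (by linarith [hs.1, hy.2]) hmono h0 (by linarith))

/-- The `L²` norm of a `C¹` function on `[a, b]` is controlled by one sample and its derivative. -/
theorem integral_sq_le_sample_add_deriv {u u' : ℝ → ℝ} {a b s : ℝ}
    (hu : ∀ t ∈ Set.Icc a b, HasDerivWithinAt u (u' t) (Set.Icc a b) t)
    (hu' : ContinuousOn u' (Set.Icc a b)) (hs : s ∈ Set.Icc a b) :
    ∫ t in a..b, u t ^ 2 ≤
      2 * (b - a) * u s ^ 2 + 2 * (b - a) ^ 2 * ∫ t in a..b, u' t ^ 2 := by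
  have hab : a ≤ b := hs.1.trans hs.2
  have hc : ContinuousOn u (Set.uIcc a b) := by
    rw [Set.uIcc_of_le hab]
    exact fun t ht => (hu t ht).continuousWithinAt
  have hpt : ∀ y ∈ Set.Icc a b,
      u y ^ 2 ≤ 2 * u s ^ 2 + 2 * ((b - a) * ∫ t in a..b, u' t ^ 2) := by
    intro y hy
    have h : (u y - u s) ^ 2 ≤ (b - a) * ∫ t in a..b, u' t ^ 2 := by
      rcases le_total s y with h | h
      · exact sq_sub_le_mul_integral_sq_deriv hu hu' hs hy h
      · rw [← neg_sub, neg_sq]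
        exact sq_sub_le_mul_integral_sq_deriv hu hu' hy hs h
    nlinarith [sq_nonneg (u y - 2 * u s)]
  calc ∫ t in a..b, u t ^ 2
      ≤ ∫ _ in a..b, (2 * u s ^ 2 + 2 * ((b - a) * ∫ t in a..b, u' t ^ 2)) :=
        intervalIntegral.integral_mono_on hab (hc.pow 2).intervalIntegrable (by simp) hpt
    _ = _ := by rw [intervalIntegral.integral_const, smul_eq_mul]; ring

/-- Averaged form of `integral_sq_le_sample_add_deriv` over a family of at least `c` samples. -/
theorem integral_sq_le_sum_samples_add_deriv {ι : Type*} {u u' : ℝ → ℝ} {a b c : ℝ}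
    (S : Finset ι) (x : ι → ℝ) (hc : 0 < c) (hcS : c ≤ (S.card : ℝ))
    (hab : a ≤ b) (hu : ∀ t ∈ Set.Icc a b, HasDerivWithinAt u (u' t) (Set.Icc a b) t)
    (hu' : ContinuousOn u' (Set.Icc a b)) (hx : ∀ i ∈ S, x i ∈ Set.Icc a b) :
    ∫ t in a..b, u t ^ 2 ≤
      2 * (b - a) / c * ∑ i ∈ S, u (x i) ^ 2 + 2 * (b - a) ^ 2 * ∫ t in a..b, u' t ^ 2 := by
  have hS : (0 : ℝ) < S.card := hc.trans_le hcS
  have h1 := Finset.sum_le_sum fun i hi => integral_sq_le_sample_add_deriv hu hu' (hx i hi)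
  rw [Finset.sum_add_distrib, ← Finset.mul_sum, Finset.sum_const, Finset.sum_const,
    nsmul_eq_mul, nsmul_eq_mul] at h1
  have h2 : 0 ≤ 2 * (b - a) * ∑ i ∈ S, u (x i) ^ 2 :=
    mul_nonneg (by linarith) (Finset.sum_nonneg fun i _ => sq_nonneg _)
  calc ∫ t in a..b, u t ^ 2
      ≤ 2 * (b - a) * (∑ i ∈ S, u (x i) ^ 2) / S.card
          + 2 * (b - a) ^ 2 * ∫ t in a..b, u' t ^ 2 := by
        rw [← sub_le_iff_le_add, le_div_iff₀ hS]
        linarith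
    _ ≤ 2 * (b - a) * (∑ i ∈ S, u (x i) ^ 2) / c
          + 2 * (b - a) ^ 2 * ∫ t in a..b, u' t ^ 2 := by gcongr
    _ = _ := by ring

/-- The observations counted by `histCount M N x (k + 1)`. -/
noncomputable def histCell (M N : ℕ) (x : Fin N → ℝ) (k : ℕ) : Finset (Fin N) :=
  Finset.univ.filter fun i =>
    if k + 1 = 1 then x i ∈ Set.Icc (0 : ℝ) ((M : ℝ)⁻¹)
    else x i ∈ Set.Ioc ((((k + 1 : ℕ) : ℝ) - 1) * (M : ℝ)⁻¹) (((k + 1 : ℕ) : ℝ) * (M : ℝ)⁻¹)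

theorem card_histCell (M N : ℕ) (x : Fin N → ℝ) (k : ℕ) :
    (histCell M N x k).card = histCount M N x (k + 1) := rfl

theorem mem_histCell {M N : ℕ} {x : Fin N → ℝ} {k : ℕ} {i : Fin N}
    (hi : i ∈ histCell M N x k) :
    x i ∈ Set.Icc ((k : ℝ) * (M : ℝ)⁻¹) (((k + 1 : ℕ) : ℝ) * (M : ℝ)⁻¹) ∧
      (k ≠ 0 → (k : ℝ) * (M : ℝ)⁻¹ < x i) := by
  rw [histCell, Finset.mem_filter] at hi
  rcases Nat.eq_zero_or_pos k with rfl | hk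
  · simpa using hi.2
  · have h := hi.2
    rw [if_neg (by omega), Nat.cast_add_one, add_sub_cancel_right] at h
    rw [Nat.cast_add_one]
    exact ⟨⟨h.1.le, h.2⟩, fun _ => h.1⟩

theorem pairwiseDisjoint_histCell (M N : ℕ) (x : Fin N → ℝ) (s : Set ℕ) :
    s.PairwiseDisjoint (histCell M N x) := by
  have key : ∀ k l, k < l → Disjoint (histCell M N x k) (histCell M N x l) := by
    intro k l hkl
    refine Finset.disjoint_left.2 fun i hk hl => ?_
    have h1 := (mem_histCell hk).1.2
    have h2 := (mem_histCell hl).2 (by omega)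
    have h3 : ((k + 1 : ℕ) : ℝ) * (M : ℝ)⁻¹ ≤ (l : ℝ) * (M : ℝ)⁻¹ := by
      gcongr
      exact hkl
    linarith
  intro k _ l _ hne
  rcases hne.lt_or_gt with h | h
  · exact key k l h
  · exact (key l k h).symm

/-- Let `0 ≤ p < q ≤ M` with `q − p ≥ 2√32` and `I′ = (pd, qd)`.
If the histogram is bounded below by `γ > 0` on `I′`, and `u` is twice continuously
differentiable on `[0,1]` satisfying the Sobolev interpolation inequality with constant
`K* = 32` on `I′` for every `ε ∈ (0, (q−p)d]`, then
`∫_{I′} u² ≤ (4/(Nγ))·Σᵢ u(xᵢ)² + 16·32²·d⁴·∫_{I′} u″²`. -/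
theorem stmt4 (M N : ℕ) (hM : 0 < M) (hN : 0 < N)
    (x : Fin N → ℝ) (hx : ∀ i, x i ∈ Set.Icc (0 : ℝ) 1)
    (p q : ℕ) (hpq : p < q) (hqM : q ≤ M)
    (hgap : 2 * Real.sqrt 32 ≤ (q : ℝ) - (p : ℝ))
    (γ : ℝ) (hγ : 0 < γ)
    (hlow : ∀ j : ℕ, p + 1 ≤ j → j ≤ q →
      γ ≤ (histCount M N x j : ℝ) / ((N : ℝ) * (M : ℝ)⁻¹))
    (u u' u'' : ℝ → ℝ)
    (hderiv : ∀ t ∈ Set.Icc (0 : ℝ) 1, HasDerivWithinAt u (u' t) (Set.Icc (0 : ℝ) 1) t)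
    (hderiv' : ∀ t ∈ Set.Icc (0 : ℝ) 1, HasDerivWithinAt u' (u'' t) (Set.Icc (0 : ℝ) 1) t)
    (hcont : ContinuousOn u'' (Set.Icc (0 : ℝ) 1))
    (hsobolev : ∀ ε : ℝ, 0 < ε → ε ≤ ((q : ℝ) - (p : ℝ)) * (M : ℝ)⁻¹ →
      (∫ t in Set.Ioo ((p : ℝ) * (M : ℝ)⁻¹) ((q : ℝ) * (M : ℝ)⁻¹), (u' t) ^ 2) ≤
        32 * ((ε ^ 2)⁻¹ *
            (∫ t in Set.Ioo ((p : ℝ) * (M : ℝ)⁻¹) ((q : ℝ) * (M : ℝ)⁻¹), (u t) ^ 2)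
          + ε ^ 2 *
            ∫ t in Set.Ioo ((p : ℝ) * (M : ℝ)⁻¹) ((q : ℝ) * (M : ℝ)⁻¹), (u'' t) ^ 2)) :
    (∫ t in Set.Ioo ((p : ℝ) * (M : ℝ)⁻¹) ((q : ℝ) * (M : ℝ)⁻¹), (u t) ^ 2) ≤
      (4 / ((N : ℝ) * γ)) * ∑ i, (u (x i)) ^ 2
        + 16 * 32 ^ 2 * ((M : ℝ)⁻¹) ^ 4 *
          ∫ t in Set.Ioo ((p : ℝ) * (M : ℝ)⁻¹) ((q : ℝ) * (M : ℝ)⁻¹), (u'' t) ^ 2 := by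
  have hM' : (0 : ℝ) < M := by exact_mod_cast hM
  have hN' : (0 : ℝ) < N := by exact_mod_cast hN
  have hpq' : (p : ℝ) < q := by exact_mod_cast hpq
  set d : ℝ := (M : ℝ)⁻¹ with hd
  have hd0 : 0 < d := inv_pos.2 hM'
  have hle : (p : ℝ) * d ≤ q * d := by gcongr
  simp only [← integral_Ioc_eq_integral_Ioo, ← intervalIntegral.integral_of_le hle] at hsobolev ⊢
  have hu : ContinuousOn u (Set.Icc 0 1) := fun t ht => (hderiv t ht).continuousWithinAt
  have hu' : ContinuousOn u' (Set.Icc 0 1) := fun t ht => (hderiv' t ht).continuousWithinAt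
  have hmono : ∀ k : ℕ, (k : ℝ) * d ≤ ((k + 1 : ℕ) : ℝ) * d := fun k => by
    gcongr
    exact Nat.le_succ k
  have hsub : ∀ k ∈ Finset.Ico p q,
      Set.Icc ((k : ℝ) * d) (((k + 1 : ℕ) : ℝ) * d) ⊆ Set.Icc 0 1 := by
    intro k hk
    refine Set.Icc_subset_Icc (by positivity) ?_
    rw [hd, ← div_eq_mul_inv, div_le_one hM']
    exact_mod_cast (Nat.succ_le_of_lt (Finset.mem_Ico.1 hk).2).trans hqM
  have hsum : ∀ f : ℝ → ℝ, ContinuousOn f (Set.Icc 0 1) →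
      ∑ k ∈ Finset.Ico p q, ∫ t in ((k : ℝ) * d)..(((k + 1 : ℕ) : ℝ) * d), f t ^ 2
        = ∫ t in ((p : ℝ) * d)..((q : ℝ) * d), f t ^ 2 := by
    intro f hf
    refine intervalIntegral.sum_integral_adjacent_intervals_Ico
      (a := fun k : ℕ => (k : ℝ) * d) hpq.le fun k hk => ?_
    refine ContinuousOn.intervalIntegrable ?_
    rw [Set.uIcc_of_le (hmono k)]
    exact (hf.pow 2).mono (hsub k (by simpa using hk))
  have hcell : ∀ k ∈ Finset.Ico p q,
      ∫ t in ((k : ℝ) * d)..(((k + 1 : ℕ) : ℝ) * d), u t ^ 2 ≤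
        2 / (N * γ) * ∑ i ∈ histCell M N x k, u (x i) ^ 2
          + 2 * d ^ 2 * ∫ t in ((k : ℝ) * d)..(((k + 1 : ℕ) : ℝ) * d), u' t ^ 2 := by
    intro k hk
    have hk' := Finset.mem_Ico.1 hk
    have hcard : γ * (N * d) ≤ ((histCell M N x k).card : ℝ) := by
      rw [card_histCell, ← le_div_iff₀ (by positivity)]
      exact hlow (k + 1) (by omega) (by omega)
    have h := integral_sq_le_sum_samples_add_deriv (histCell M N x k) x (by positivity) hcard
      (hmono k) (fun t ht => (hderiv t (hsub k hk ht)).mono (hsub k hk)) (hu'.mono (hsub k hk))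
      (fun i hi => (mem_histCell hi).1)
    have hlen : ((k + 1 : ℕ) : ℝ) * d - k * d = d := by push_cast; ring
    have hcoef : 2 * d / (γ * (N * d)) = 2 / (N * γ) := by field_simp
    rwa [hlen, hcoef] at h
  have hsamples : ∑ k ∈ Finset.Ico p q, ∑ i ∈ histCell M N x k, u (x i) ^ 2
      ≤ ∑ i, u (x i) ^ 2 := by
    rw [← Finset.sum_biUnion (pairwiseDisjoint_histCell M N x _)]
    exact Finset.sum_le_sum_of_subset_of_nonneg (Finset.subset_univ _) fun i _ _ => sq_nonneg _
  have htotal := Finset.sum_le_sum hcell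
  rw [Finset.sum_add_distrib, ← Finset.mul_sum, ← Finset.mul_sum, hsum u hu, hsum u' hu'] at htotal
  have hscaled := mul_le_mul_of_nonneg_left hsamples (by positivity : 0 ≤ 2 / (N * γ))
  have hinterp := hsobolev (2 * √32 * d) (by positivity) (by gcongr)
  have hsq : (2 * √32 * d) ^ 2 = 128 * d ^ 2 := by
    rw [mul_pow, mul_pow, Real.sq_sqrt (by norm_num)]
    norm_num
  rw [hsq] at hinterp
  have hderivTerm := mul_le_mul_of_nonneg_left hinterp (by positivity : 0 ≤ 2 * d ^ 2)
  have hexpand : ∀ A B : ℝ, 2 * d ^ 2 * (32 * ((128 * d ^ 2)⁻¹ * A + 128 * d ^ 2 * B))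
      = A / 2 + 8192 * d ^ 4 * B := by
    intro A B
    field_simp
    ring
  rw [hexpand] at hderivTerm
  have hcoef : 4 / (N * γ) = 2 * (2 / (N * γ)) := by ring
  rw [hcoef]
  linarith
end

section
/- Let M ≥ 3 and N be positive integers with N ≥ M, d = 1/M, σ > 0, δ ∈ (0,1), β > 0, γ > 0, F ≥ 0, K > 0. Let p, q be integers with 0 ≤ p < q ≤ M and q − p ≥ 2√32, set I′ = (pd, qd) and ε₀ = max{√σ, (q−p)d}, and suppose N_j/(N d) ≥ γ for every j with p+1 ≤ j ≤ q. Let u₁, u₂ : [0,1] → ℝ be twice continuously differentiable with (1/N)·Σ_{i=1}^N u₁(x_i)² ≤ (Mσ²/N)·F² + d⁴·((9/8)β + 1)·F², ∫_0^1 u₁″(x)² dx ≤ ((9/4)β + 4)·F², (1/N)·Σ_{i=1}^N u₂(x_i)² ≤ 4σ²M/(δN), and ∫_0^1 u₂″(x)² dx ≤ 1/δ. Suppose that for v ∈ {u₁, u₂}: (a) for every ε ∈ (0, (q−p)d], ∫_{I′} v′(x)² dx ≤ 32( ε⁻²·∫_{I′} v(x)² dx + ε²·∫_{I′} v″(x)²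 dx ); and (b) for every ε ∈ (0, ε₀], ∫_{I′} v′(x)² dx ≤ K( ε⁻²·∫_{I′} v(x)² dx + ε²·∫_{I′} v″(x)² dx ). Then ( ∫_{I′} (u₁′(x) + u₂′(x))² dx )^{1/2} ≤ C₃·(Mσ²/N)^{1/4} + C₄·M⁻¹, where C₃ = K^{1/2}·( F·√( 4γ^{−1} + (9/4)β + 4 ) + δ^{−1/2}·√( 16γ^{−1} + 1 ) ) and C₄ = K^{1/2}·( F·√( (9β+8)/(8·32·γ) + 18·32·β + 32·32 ) + 2√2·δ^{−1/2}·√32 ). -/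
open MeasureTheory Finset intervalIntegral
open scoped Classical

/-- Cauchy–Schwarz for real integrals. -/
theorem sq_integral_mul_le {α : Type*} [MeasurableSpace α] {μ : Measure α} {f g : α → ℝ}
    (hf : Integrable (fun t => f t ^ 2) μ) (hg : Integrable (fun t => g t ^ 2) μ)
    (hfg : Integrable (fun t => f t * g t) μ) :
    (∫ t, f t * g t ∂μ) ^ 2 ≤ (∫ t, f t ^ 2 ∂μ) * ∫ t, g t ^ 2 ∂μ := by
  have key : ∀ c : ℝ, 0 ≤ (∫ t, f t ^ 2 ∂μ) * (c * c) + (2 * ∫ t, f t * g t ∂μ) * c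
      + ∫ t, g t ^ 2 ∂μ := by
    intro c
    have h : ∫ t, (c * f t + g t) ^ 2 ∂μ = (∫ t, f t ^ 2 ∂μ) * (c * c)
        + (2 * ∫ t, f t * g t ∂μ) * c + ∫ t, g t ^ 2 ∂μ := by
      have e : (fun t => (c * f t + g t) ^ 2)
          = fun t => ((c * c) * f t ^ 2 + (2 * c) * (f t * g t)) + g t ^ 2 := by
        funext t; ring
      have h12 : Integrable (fun t => (c * c) * f t ^ 2 + (2 * c) * (f t * g t)) μ :=
        (hf.const_mul _).add (hfg.const_mul _)
      rw [e, integral_add h12 hg, integral_add (hf.const_mul _) (hfg.const_mul _),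
        MeasureTheory.integral_const_mul, MeasureTheory.integral_const_mul]
      ring
    rw [← h]
    exact integral_nonneg fun t => sq_nonneg _
  have := discrim_le_zero key
  unfold discrim at this
  linarith

/-- Minkowski's inequality for the real `L²` seminorm. -/
theorem sqrt_integral_add_sq_le {α : Type*} [MeasurableSpace α] {μ : Measure α} {f g : α → ℝ}
    (hf : Integrable (fun t => f t ^ 2) μ) (hg : Integrable (fun t => g t ^ 2) μ)
    (hfg : Integrable (fun t => f t * g t) μ) :
    √(∫ t, (f t + g t) ^ 2 ∂μ) ≤ √(∫ t, f t ^ 2 ∂μ) + √(∫ t, g t ^ 2 ∂μ) := by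
  have hf0 : 0 ≤ ∫ t, f t ^ 2 ∂μ := integral_nonneg fun t => sq_nonneg _
  have hg0 : 0 ≤ ∫ t, g t ^ 2 ∂μ := integral_nonneg fun t => sq_nonneg _
  have h : ∫ t, (f t + g t) ^ 2 ∂μ
      = (∫ t, f t ^ 2 ∂μ) + 2 * (∫ t, f t * g t ∂μ) + ∫ t, g t ^ 2 ∂μ := by
    have e : (fun t => (f t + g t) ^ 2)
        = fun t => (f t ^ 2 + 2 * (f t * g t)) + g t ^ 2 := by
      funext t; ring
    have h12 : Integrable (fun t => f t ^ 2 + 2 * (f t * g t)) μ := hf.add (hfg.const_mul _)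
    rw [e, integral_add h12 hg, integral_add hf (hfg.const_mul _), MeasureTheory.integral_const_mul]
  have hcs : ∫ t, f t * g t ∂μ ≤ √(∫ t, f t ^ 2 ∂μ) * √(∫ t, g t ^ 2 ∂μ) := by
    rw [← Real.sqrt_mul hf0]
    exact Real.le_sqrt_of_sq_le (sq_integral_mul_le hf hg hfg)
  apply Real.sqrt_le_iff.2 ⟨by positivity, ?_⟩
  rw [h, add_sq, Real.sq_sqrt hf0, Real.sq_sqrt hg0]
  linarith

theorem sq_sub_le_mul_integral_sq_deriv_s18 {v v' : ℝ → ℝ} {a b s t : ℝ}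
    (hv : ∀ r ∈ Set.Icc a b, HasDerivWithinAt v (v' r) (Set.Icc a b) r)
    (hv' : ContinuousOn v' (Set.Icc a b)) (hs : a ≤ s) (hst : s ≤ t) (ht : t ≤ b) :
    (v t - v s) ^ 2 ≤ (b - a) * ∫ r in a..b, v' r ^ 2 := by
  have hab : a ≤ b := hs.trans (hst.trans ht)
  have hsub : Set.Icc s t ⊆ Set.Icc a b := Set.Icc_subset_Icc hs ht
  have hc : ContinuousOn v' (Set.Icc s t) := hv'.mono hsub
  have hint : ∀ {f : ℝ → ℝ}, ContinuousOn f (Set.Icc s t) →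
      Integrable f (volume.restrict (Set.Ioc s t)) := fun hf =>
    (hf.integrableOn_Icc).mono_set Set.Ioc_subset_Icc_self
  have hftc : ∫ r in s..t, v' r = v t - v s := by
    apply integral_eq_sub_of_hasDerivAt_of_le hst
    · exact fun r hr => ((hv r (hsub hr)).mono hsub).continuousWithinAt
    · intro r hr
      exact (hv r (hsub (Set.Ioo_subset_Icc_self hr))).hasDerivAt
        (Icc_mem_nhds (hs.trans_lt hr.1) (hr.2.trans_le ht))
    · rw [intervalIntegrable_iff_integrableOn_Ioc_of_le hst]
      exact hint hc
  have hcs := sq_integral_mul_le (μ := volume.restrict (Set.Ioc s t)) (f := v')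
    (g := fun _ => (1 : ℝ)) (hint (hc.pow 2)) (by simp) (by simpa using hint hc)
  simp only [mul_one, one_pow] at hcs
  rw [← integral_of_le hst, ← integral_of_le hst, ← integral_of_le hst, hftc,
    intervalIntegral.integral_const, smul_eq_mul, mul_one] at hcs
  have hmono : ∫ r in s..t, v' r ^ 2 ≤ ∫ r in a..b, v' r ^ 2 := by
    apply integral_mono_interval hs hst ht (ae_of_all _ fun r => sq_nonneg _)
    exact ((hv'.pow 2).intervalIntegrable_of_Icc hab)
  have h0 : 0 ≤ ∫ r in s..t, v' r ^ 2 := integral_nonneg hst fun r _ => sq_nonneg _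
  calc _ ≤ _ := hcs
    _ ≤ (∫ r in a..b, v' r ^ 2) * (b - a) := by
      gcongr
      linarith
    _ = _ := mul_comm _ _

theorem integral_sq_le_of_mem_Icc {v v' : ℝ → ℝ} {a b s : ℝ}
    (hv : ∀ r ∈ Set.Icc a b, HasDerivWithinAt v (v' r) (Set.Icc a b) r)
    (hv' : ContinuousOn v' (Set.Icc a b)) (hs : s ∈ Set.Icc a b) :
    ∫ t in a..b, v t ^ 2
      ≤ 2 * (b - a) * v s ^ 2 + 2 * (b - a) ^ 2 * ∫ t in a..b, v' t ^ 2 := by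
  have hab : a ≤ b := hs.1.trans hs.2
  have hc : ContinuousOn v (Set.Icc a b) := fun r hr => (hv r hr).continuousWithinAt
  have hpt : ∀ t ∈ Set.Icc a b,
      v t ^ 2 ≤ 2 * v s ^ 2 + 2 * ((b - a) * ∫ r in a..b, v' r ^ 2) := by
    intro t ht
    have h : (v t - v s) ^ 2 ≤ (b - a) * ∫ r in a..b, v' r ^ 2 := by
      rcases le_total s t with h | h
      · exact sq_sub_le_mul_integral_sq_deriv_s18 hv hv' hs.1 h ht.2
      · rw [← neg_sub, neg_sq]
        exact sq_sub_le_mul_integral_sq_deriv_s18 hv hv' ht.1 h hs.2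
    nlinarith [sq_nonneg (v t - 2 * v s)]
  calc _ ≤ ∫ t in a..b, (2 * v s ^ 2 + 2 * ((b - a) * ∫ r in a..b, v' r ^ 2)) :=
        integral_mono_on hab ((hc.pow 2).intervalIntegrable_of_Icc hab) (by simp) hpt
    _ = _ := by
      rw [intervalIntegral.integral_const, smul_eq_mul]
      ring

/-- The observation points lying in the `j`-th cell. -/
noncomputable def cellPoints (M N : ℕ) (x : Fin N → ℝ) (j : ℕ) : Finset (Fin N) :=
  Finset.univ.filter (fun i : Fin N =>
    if j = 1 then x i ∈ Set.Icc (0 : ℝ) ((M : ℝ)⁻¹)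
    else x i ∈ Set.Ioc (((j : ℝ) - 1) * (M : ℝ)⁻¹) ((j : ℝ) * (M : ℝ)⁻¹))

theorem card_cellPoints (M N : ℕ) (x : Fin N → ℝ) (j : ℕ) :
    (cellPoints M N x j).card = histCount M N x j := rfl

theorem mem_Icc_of_mem_cellPoints {M N : ℕ} {x : Fin N → ℝ} {k : ℕ} {i : Fin N}
    (hi : i ∈ cellPoints M N x (k + 1)) :
    x i ∈ Set.Icc ((k : ℝ) * (M : ℝ)⁻¹) (((k + 1 : ℕ) : ℝ) * (M : ℝ)⁻¹) := by
  simp only [cellPoints, Finset.mem_filter, Finset.mem_univ, true_and] at hi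
  split_ifs at hi with h
  · obtain rfl : k = 0 := by omega
    simpa using hi
  · push_cast at hi ⊢
    rw [add_sub_cancel_right] at hi
    exact Set.Ioc_subset_Icc_self hi

theorem lt_of_mem_cellPoints {M N : ℕ} {x : Fin N → ℝ} {k : ℕ} {i : Fin N} (hk : k ≠ 0)
    (hi : i ∈ cellPoints M N x (k + 1)) : (k : ℝ) * (M : ℝ)⁻¹ < x i := by
  simp only [cellPoints, Finset.mem_filter, Finset.mem_univ, true_and] at hi
  rw [if_neg (by omega)] at hi
  push_cast at hi
  rw [add_sub_cancel_right] at hi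
  exact hi.1

theorem disjoint_cellPoints {M N : ℕ} {x : Fin N → ℝ} {k l : ℕ} (h : k < l) :
    Disjoint (cellPoints M N x (k + 1)) (cellPoints M N x (l + 1)) := by
  rw [Finset.disjoint_left]
  intro i hk hl
  have h1 := (mem_Icc_of_mem_cellPoints hk).2
  have h2 := lt_of_mem_cellPoints (by omega) hl
  have h3 : ((k + 1 : ℕ) : ℝ) ≤ l := by exact_mod_cast h
  have h4 : ((k + 1 : ℕ) : ℝ) * (M : ℝ)⁻¹ ≤ l * (M : ℝ)⁻¹ := by gcongr
  linarith

theorem sum_cellPoints_le {M N : ℕ} {x : Fin N → ℝ} (s : Finset ℕ) {f : Fin N → ℝ}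
    (hf : ∀ i, 0 ≤ f i) : ∑ k ∈ s, ∑ i ∈ cellPoints M N x (k + 1), f i ≤ ∑ i, f i := by
  rw [← Finset.sum_biUnion]
  · exact Finset.sum_le_sum_of_subset_of_nonneg (Finset.subset_univ _) fun i _ _ => hf i
  · intro k _ l _ hkl
    rcases lt_or_gt_of_ne hkl with h | h
    · exact disjoint_cellPoints h
    · exact (disjoint_cellPoints h).symm

theorem integral_Ioo_sq_le_sum {M N : ℕ} (hM : 0 < M) (hN : 0 < N) {γ : ℝ} (hγ : 0 < γ)
    {x : Fin N → ℝ} {p q : ℕ} (hpq : p ≤ q) (hqM : q ≤ M)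
    (hlow : ∀ j : ℕ, p + 1 ≤ j → j ≤ q →
      γ ≤ (histCount M N x j : ℝ) / ((N : ℝ) * (M : ℝ)⁻¹))
    {v v' : ℝ → ℝ}
    (hv : ∀ t ∈ Set.Icc (0 : ℝ) 1, HasDerivWithinAt v (v' t) (Set.Icc (0 : ℝ) 1) t)
    (hv' : ContinuousOn v' (Set.Icc (0 : ℝ) 1)) :
    (∫ t in Set.Ioo ((p : ℝ) * (M : ℝ)⁻¹) ((q : ℝ) * (M : ℝ)⁻¹), (v t) ^ 2)
      ≤ 2 / γ * ((1 / (N : ℝ)) * ∑ i, v (x i) ^ 2) + 2 * ((M : ℝ)⁻¹) ^ 2 *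
        ∫ t in Set.Ioo ((p : ℝ) * (M : ℝ)⁻¹) ((q : ℝ) * (M : ℝ)⁻¹), (v' t) ^ 2 := by
  have hM' : (0 : ℝ) < M := by exact_mod_cast hM
  have hN' : (0 : ℝ) < N := by exact_mod_cast hN
  have hsub : ∀ {k : ℕ}, k < q →
      Set.Icc ((k : ℝ) * (M : ℝ)⁻¹) (((k + 1 : ℕ) : ℝ) * (M : ℝ)⁻¹) ⊆ Set.Icc 0 1 := by
    intro k hk
    apply Set.Icc_subset_Icc (by positivity)
    rw [← div_eq_mul_inv, div_le_one hM']
    exact_mod_cast (Nat.succ_le_of_lt hk).trans hqM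
  have hle : ∀ k : ℕ, (k : ℝ) * (M : ℝ)⁻¹ ≤ ((k + 1 : ℕ) : ℝ) * (M : ℝ)⁻¹ := by
    intro k
    gcongr
    simp
  have hsum : ∀ {f : ℝ → ℝ}, ContinuousOn f (Set.Icc 0 1) →
      ∫ t in Set.Ioo ((p : ℝ) * (M : ℝ)⁻¹) ((q : ℝ) * (M : ℝ)⁻¹), f t
        = ∑ k ∈ Finset.Ico p q, ∫ t in (k : ℝ) * (M : ℝ)⁻¹..((k + 1 : ℕ) : ℝ) * (M : ℝ)⁻¹, f t := by
    intro f hf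
    rw [sum_integral_adjacent_intervals_Ico (a := fun k : ℕ => (k : ℝ) * (M : ℝ)⁻¹) hpq,
      integral_of_le (by gcongr), integral_Ioc_eq_integral_Ioo]
    intro k hk
    exact (hf.mono (hsub hk.2)).intervalIntegrable_of_Icc (hle k)
  have hc : ContinuousOn v (Set.Icc 0 1) := fun t ht => (hv t ht).continuousWithinAt
  rw [hsum (f := fun t => v t ^ 2) (hc.pow 2), hsum (f := fun t => v' t ^ 2) (hv'.pow 2)]
  have hcell : ∀ k ∈ Finset.Ico p q,
      ∫ t in (k : ℝ) * (M : ℝ)⁻¹..((k + 1 : ℕ) : ℝ) * (M : ℝ)⁻¹, v t ^ 2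
        ≤ 2 / (γ * N) * (∑ i ∈ cellPoints M N x (k + 1), v (x i) ^ 2) + 2 * ((M : ℝ)⁻¹) ^ 2 *
          ∫ t in (k : ℝ) * (M : ℝ)⁻¹..((k + 1 : ℕ) : ℝ) * (M : ℝ)⁻¹, v' t ^ 2 := by
    intro k hk
    rw [Finset.mem_Ico] at hk
    set A := ∫ t in (k : ℝ) * (M : ℝ)⁻¹..((k + 1 : ℕ) : ℝ) * (M : ℝ)⁻¹, v t ^ 2
    set B := ∫ t in (k : ℝ) * (M : ℝ)⁻¹..((k + 1 : ℕ) : ℝ) * (M : ℝ)⁻¹, v' t ^ 2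
    have hlen : ((k + 1 : ℕ) : ℝ) * (M : ℝ)⁻¹ - (k : ℝ) * (M : ℝ)⁻¹ = (M : ℝ)⁻¹ := by
      push_cast; ring
    have hpt : ∀ i ∈ cellPoints M N x (k + 1),
        A ≤ 2 * (M : ℝ)⁻¹ * v (x i) ^ 2 + 2 * ((M : ℝ)⁻¹) ^ 2 * B := by
      intro i hi
      have := integral_sq_le_of_mem_Icc (fun r hr => (hv r (hsub hk.2 hr)).mono (hsub hk.2))
        (hv'.mono (hsub hk.2)) (mem_Icc_of_mem_cellPoints hi)
      rwa [hlen] at this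
    have hS := Finset.sum_le_sum hpt
    rw [Finset.sum_const, Finset.sum_add_distrib, Finset.sum_const, ← Finset.mul_sum,
      card_cellPoints, nsmul_eq_mul, nsmul_eq_mul] at hS
    have hl := hlow (k + 1) (by omega) (by omega)
    rw [le_div_iff₀ (by positivity)] at hl
    set n : ℝ := (histCount M N x (k + 1) : ℝ)
    set S := ∑ i ∈ cellPoints M N x (k + 1), v (x i) ^ 2
    have hS0 : 0 ≤ S := Finset.sum_nonneg fun i _ => sq_nonneg _
    have hn : 0 < n := lt_of_lt_of_le (by positivity) hl
    have h1 : A - 2 * ((M : ℝ)⁻¹) ^ 2 * B ≤ 2 * (M : ℝ)⁻¹ * S / n := by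
      rw [le_div_iff₀ hn]
      linarith
    have h2 : 2 * (M : ℝ)⁻¹ * S / n ≤ 2 * (M : ℝ)⁻¹ * S / (γ * (N * (M : ℝ)⁻¹)) := by
      gcongr
    have h3 : 2 * (M : ℝ)⁻¹ * S / (γ * (N * (M : ℝ)⁻¹)) = 2 / (γ * N) * S := by
      field_simp
    linarith
  refine (Finset.sum_le_sum hcell).trans ?_
  rw [Finset.sum_add_distrib, ← Finset.mul_sum, ← Finset.mul_sum]
  have h := sum_cellPoints_le (M := M) (x := x) (Finset.Ico p q)
    (f := fun i => v (x i) ^ 2) fun i => sq_nonneg _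
  have e : 2 / γ * ((1 / (N : ℝ)) * ∑ i, v (x i) ^ 2) = 2 / (γ * N) * ∑ i, v (x i) ^ 2 := by
    field_simp
  rw [e]
  gcongr

theorem setIntegral_Ioo_sq_le {f : ℝ → ℝ} (hf : ContinuousOn f (Set.Icc 0 1)) {a b : ℝ}
    (ha : 0 ≤ a) (hb : b ≤ 1) :
    ∫ t in Set.Ioo a b, f t ^ 2 ≤ ∫ t in (0 : ℝ)..1, f t ^ 2 := by
  rw [integral_of_le zero_le_one]
  apply setIntegral_mono_set
  · exact ((hf.pow 2).integrableOn_Icc).mono_set Set.Ioc_subset_Icc_self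
  · exact ae_of_all _ fun t => sq_nonneg _
  · exact Filter.Eventually.of_forall fun t ht => ⟨ha.trans_lt ht.1, ht.2.le.trans hb⟩

/-- Interpolation with step `ε² = max (√s) (128 d²)`, after absorbing the derivative term of
the quadrature error with step `ε² = 128 d²`. -/
theorem sobolev_absorption {A B C S d s ε₀ ε₁ K γ a b c : ℝ} (hd : 0 < d) (hs : 0 < s)
    (hγ : 0 < γ) (hK : 0 < K) (hC : C ≤ c) (hC0 : 0 ≤ C)
    (hS : S ≤ a * s + b * d ^ 4) (hb : 0 ≤ b) (ha : 0 ≤ a)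
    (hA : A ≤ 2 / γ * S + 2 * d ^ 2 * B)
    (hε₁ : 128 * d ^ 2 ≤ ε₁ ^ 2) (hε₁0 : 0 < ε₁)
    (h32 : ∀ ε, 0 < ε → ε ≤ ε₁ → B ≤ 32 * ((ε ^ 2)⁻¹ * A + ε ^ 2 * C))
    (hsε₀ : √s ≤ ε₀ ^ 2) (hε₁₀ : ε₁ ≤ ε₀)
    (hKi : ∀ ε, 0 < ε → ε ≤ ε₀ → B ≤ K * ((ε ^ 2)⁻¹ * A + ε ^ 2 * C)) :
    B ≤ K * ((4 * a / γ + c) * √s + (b / (32 * γ) + 256 * c) * d ^ 2) := by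
  have hc : 0 ≤ c := hC0.trans hC
  have hA' : A ≤ 4 / γ * (a * s + b * d ^ 4) + 16384 * d ^ 4 * c := by
    have h := h32 √(128 * d ^ 2) (by positivity)
      (Real.sqrt_le_iff.2 ⟨hε₁0.le, hε₁⟩)
    rw [Real.sq_sqrt (by positivity)] at h
    have h2 : 2 * d ^ 2 * B ≤ A / 2 + 8192 * d ^ 4 * C := by
      calc 2 * d ^ 2 * B ≤ 2 * d ^ 2 * (32 * ((128 * d ^ 2)⁻¹ * A + 128 * d ^ 2 * C)) := by
            gcongr
        _ = _ := by field_simp; ring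
    have h3 : 2 / γ * S ≤ 2 / γ * (a * s + b * d ^ 4) := by gcongr
    have h4 : d ^ 4 * C ≤ d ^ 4 * c := by gcongr
    have h5 : 4 / γ * (a * s + b * d ^ 4) = 2 * (2 / γ * (a * s + b * d ^ 4)) := by ring
    linarith
  set m := max √s (128 * d ^ 2) with hm
  have hm1 : √s ≤ m := le_max_left _ _
  have hm2 : 128 * d ^ 2 ≤ m := le_max_right _ _
  have hrs : 0 < √s := Real.sqrt_pos.2 hs
  have hm0 : 0 < m := hrs.trans_le hm1
  have hm3 : m ≤ √s + 128 * d ^ 2 := max_le (by nlinarith [sq_nonneg d]) (by linarith)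
  have hm4 : m ≤ ε₀ ^ 2 := max_le hsε₀ (hε₁.trans (by gcongr))
  have h := hKi √m (by positivity) (Real.sqrt_le_iff.2 ⟨hε₁0.le.trans hε₁₀, hm4⟩)
  rw [Real.sq_sqrt hm0.le] at h
  refine h.trans (mul_le_mul_of_nonneg_left ?_ hK.le)
  have h1 : m⁻¹ * s ≤ √s := by
    rw [inv_mul_le_iff₀ hm0]
    nlinarith [Real.sq_sqrt hs.le]
  have h2 : m⁻¹ * d ^ 4 ≤ d ^ 2 / 128 := by
    rw [inv_mul_le_iff₀ hm0]
    nlinarith [sq_nonneg d]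
  calc m⁻¹ * A + m * C
      ≤ m⁻¹ * (4 / γ * (a * s + b * d ^ 4) + 16384 * d ^ 4 * c) + (√s + 128 * d ^ 2) * c := by
        gcongr
    _ = 4 * a / γ * (m⁻¹ * s) + (4 * b / γ + 16384 * c) * (m⁻¹ * d ^ 4)
        + (√s + 128 * d ^ 2) * c := by ring
    _ ≤ 4 * a / γ * √s + (4 * b / γ + 16384 * c) * (d ^ 2 / 128)
        + (√s + 128 * d ^ 2) * c := by gcongr
    _ = _ := by field_simp; ring

theorem sqrt_mul_sq_add_le {K F P Q r d : ℝ} (hK : 0 ≤ K) (hF : 0 ≤ F) (hP : 0 ≤ P)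
    (hQ : 0 ≤ Q) (hr : 0 ≤ r) (hd : 0 ≤ d) :
    √(K * (F ^ 2 * (P * r + Q * d ^ 2))) ≤ √K * (F * (√P * √r + √Q * d)) := by
  rw [Real.sqrt_mul hK, Real.sqrt_mul (sq_nonneg F), Real.sqrt_sq hF]
  gcongr
  apply Real.sqrt_le_iff.2 ⟨by positivity, ?_⟩
  have h1 := Real.sq_sqrt hP
  have h2 := Real.sq_sqrt hQ
  have h3 := Real.sq_sqrt hr
  have h4 : 0 ≤ √P * √r * (√Q * d) := by positivity
  calc P * r + Q * d ^ 2 = √P ^ 2 * √r ^ 2 + √Q ^ 2 * d ^ 2 := by rw [h1, h2, h3]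
    _ ≤ _ := by nlinarith

/-- Error bound in the continuous `L²` norm for the reconstructed
derivative on a reliable subinterval `I′ = (pd, qd)`: with `u₁` the deterministic error
part and `u₂` the noise part (satisfying the bounds established for these parts, the
Sobolev interpolation inequality with constant `K* = 32` on `I′` for `ε ∈ (0,(q−p)d]`,
and with constant `K = K_σ` for `ε ∈ (0, ε₀]` where `ε₀ = max{√σ, (q−p)d}`),
`‖u₁′ + u₂′‖_{L²(I′)} ≤ C₃·(Mσ²/N)^{1/4} + C₄·M⁻¹`. -/
theorem stmt18 (M N : ℕ) (hM : 3 ≤ M) (hNM : M ≤ N)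
    (σ δ β γ F : ℝ) (hσ : 0 < σ) (hδ₀ : 0 < δ) (hδ₁ : δ < 1)
    (hβ : 0 < β) (hγ : 0 < γ) (hF : 0 ≤ F) (K : ℝ) (hK : 0 < K)
    (x : Fin N → ℝ) (hx : ∀ i, x i ∈ Set.Icc (0 : ℝ) 1)
    (p q : ℕ) (hpq : p < q) (hqM : q ≤ M)
    (hgap : 2 * Real.sqrt 32 ≤ (q : ℝ) - (p : ℝ))
    (hlow : ∀ j : ℕ, p + 1 ≤ j → j ≤ q →
      γ ≤ (histCount M N x j : ℝ) / ((N : ℝ) * (M : ℝ)⁻¹))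
    (u₁ u₁' u₁'' u₂ u₂' u₂'' : ℝ → ℝ)
    (hu₁ : ∀ t ∈ Set.Icc (0 : ℝ) 1, HasDerivWithinAt u₁ (u₁' t) (Set.Icc (0 : ℝ) 1) t)
    (hu₁' : ∀ t ∈ Set.Icc (0 : ℝ) 1, HasDerivWithinAt u₁' (u₁'' t) (Set.Icc (0 : ℝ) 1) t)
    (hu₁'' : ContinuousOn u₁'' (Set.Icc (0 : ℝ) 1))
    (hu₂ : ∀ t ∈ Set.Icc (0 : ℝ) 1, HasDerivWithinAt u₂ (u₂' t) (Set.Icc (0 : ℝ) 1) t)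
    (hu₂' : ∀ t ∈ Set.Icc (0 : ℝ) 1, HasDerivWithinAt u₂' (u₂'' t) (Set.Icc (0 : ℝ) 1) t)
    (hu₂'' : ContinuousOn u₂'' (Set.Icc (0 : ℝ) 1))
    -- bounds for the deterministic part u₁
    (hmse₁ : (1 / (N : ℝ)) * (∑ i, (u₁ (x i)) ^ 2) ≤
      ((M : ℝ) * σ ^ 2 / (N : ℝ)) * F ^ 2 + ((M : ℝ)⁻¹) ^ 4 * ((9 / 8) * β + 1) * F ^ 2)
    (hsec₁ : (∫ t in (0 : ℝ)..1, (u₁'' t) ^ 2) ≤ ((9 / 4) * β + 4) * F ^ 2)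
    -- bounds for the noise part u₂
    (hmse₂ : (1 / (N : ℝ)) * (∑ i, (u₂ (x i)) ^ 2) ≤ 4 * σ ^ 2 * (M : ℝ) / (δ * (N : ℝ)))
    (hsec₂ : (∫ t in (0 : ℝ)..1, (u₂'' t) ^ 2) ≤ 1 / δ)
    -- Sobolev interpolation inequality with constant K* = 32 on I′ for u₁ and u₂
    (hsobolev₁ : ∀ ε : ℝ, 0 < ε → ε ≤ ((q : ℝ) - (p : ℝ)) * (M : ℝ)⁻¹ →
      (∫ t in Set.Ioo ((p : ℝ) * (M : ℝ)⁻¹) ((q : ℝ) * (M : ℝ)⁻¹), (u₁' t) ^ 2) ≤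
        32 * ((ε ^ 2)⁻¹ *
            (∫ t in Set.Ioo ((p : ℝ) * (M : ℝ)⁻¹) ((q : ℝ) * (M : ℝ)⁻¹), (u₁ t) ^ 2)
          + ε ^ 2 *
            ∫ t in Set.Ioo ((p : ℝ) * (M : ℝ)⁻¹) ((q : ℝ) * (M : ℝ)⁻¹), (u₁'' t) ^ 2))
    (hsobolev₂ : ∀ ε : ℝ, 0 < ε → ε ≤ ((q : ℝ) - (p : ℝ)) * (M : ℝ)⁻¹ →
      (∫ t in Set.Ioo ((p : ℝ) * (M : ℝ)⁻¹) ((q : ℝ) * (M : ℝ)⁻¹), (u₂' t) ^ 2) ≤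
        32 * ((ε ^ 2)⁻¹ *
            (∫ t in Set.Ioo ((p : ℝ) * (M : ℝ)⁻¹) ((q : ℝ) * (M : ℝ)⁻¹), (u₂ t) ^ 2)
          + ε ^ 2 *
            ∫ t in Set.Ioo ((p : ℝ) * (M : ℝ)⁻¹) ((q : ℝ) * (M : ℝ)⁻¹), (u₂'' t) ^ 2))
    -- Sobolev interpolation inequality with constant K = K_σ on I′ for u₁ and u₂,
    -- for ε in (0, ε₀] with ε₀ = max {√σ, (q−p)d}
    (hsobolevK₁ : ∀ ε : ℝ, 0 < ε →
      ε ≤ max (Real.sqrt σ) (((q : ℝ) - (p : ℝ)) * (M : ℝ)⁻¹) →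
      (∫ t in Set.Ioo ((p : ℝ) * (M : ℝ)⁻¹) ((q : ℝ) * (M : ℝ)⁻¹), (u₁' t) ^ 2) ≤
        K * ((ε ^ 2)⁻¹ *
            (∫ t in Set.Ioo ((p : ℝ) * (M : ℝ)⁻¹) ((q : ℝ) * (M : ℝ)⁻¹), (u₁ t) ^ 2)
          + ε ^ 2 *
            ∫ t in Set.Ioo ((p : ℝ) * (M : ℝ)⁻¹) ((q : ℝ) * (M : ℝ)⁻¹), (u₁'' t) ^ 2))
    (hsobolevK₂ : ∀ ε : ℝ, 0 < ε →
      ε ≤ max (Real.sqrt σ) (((q : ℝ) - (p : ℝ)) * (M : ℝ)⁻¹) →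
      (∫ t in Set.Ioo ((p : ℝ) * (M : ℝ)⁻¹) ((q : ℝ) * (M : ℝ)⁻¹), (u₂' t) ^ 2) ≤
        K * ((ε ^ 2)⁻¹ *
            (∫ t in Set.Ioo ((p : ℝ) * (M : ℝ)⁻¹) ((q : ℝ) * (M : ℝ)⁻¹), (u₂ t) ^ 2)
          + ε ^ 2 *
            ∫ t in Set.Ioo ((p : ℝ) * (M : ℝ)⁻¹) ((q : ℝ) * (M : ℝ)⁻¹), (u₂'' t) ^ 2)) :
    Real.sqrt (∫ t in Set.Ioo ((p : ℝ) * (M : ℝ)⁻¹) ((q : ℝ) * (M : ℝ)⁻¹),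
        (u₁' t + u₂' t) ^ 2) ≤
      Real.sqrt K * (F * Real.sqrt (4 / γ + (9 / 4) * β + 4)
          + (1 / Real.sqrt δ) * Real.sqrt (16 / γ + 1))
        * Real.sqrt (Real.sqrt ((M : ℝ) * σ ^ 2 / (N : ℝ)))
        + Real.sqrt K * (F * Real.sqrt ((9 * β + 8) / (8 * 32 * γ) + 18 * 32 * β + 32 * 32)
            + 2 * Real.sqrt 2 * (1 / Real.sqrt δ) * Real.sqrt 32) * ((M : ℝ))⁻¹ := by
  have hM0 : (0 : ℝ) < M := by exact_mod_cast (by omega : 0 < M)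
  have hN0 : (0 : ℝ) < N := by exact_mod_cast (by omega : 0 < N)
  have hc₁ : ContinuousOn u₁' (Set.Icc 0 1) := fun t ht => (hu₁' t ht).continuousWithinAt
  have hc₂ : ContinuousOn u₂' (Set.Icc 0 1) := fun t ht => (hu₂' t ht).continuousWithinAt
  have hA₁ := integral_Ioo_sq_le_sum (by omega) (by omega) hγ hpq.le hqM hlow hu₁ hc₁
  have hA₂ := integral_Ioo_sq_le_sum (by omega) (by omega) hγ hpq.le hqM hlow hu₂ hc₂
  have ha : 0 ≤ (p : ℝ) * (M : ℝ)⁻¹ := by positivity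
  have hb : (q : ℝ) * (M : ℝ)⁻¹ ≤ 1 := by
    rw [← div_eq_mul_inv, div_le_one hM0]
    exact_mod_cast hqM
  have hC₁ := (setIntegral_Ioo_sq_le hu₁'' ha hb).trans hsec₁
  have hC₂ := (setIntegral_Ioo_sq_le hu₂'' ha hb).trans hsec₂
  have hmink := sqrt_integral_add_sq_le (f := u₁') (g := u₂')
    (μ := volume.restrict (Set.Ioo ((p : ℝ) * (M : ℝ)⁻¹) ((q : ℝ) * (M : ℝ)⁻¹)))
    (((hc₁.pow 2).integrableOn_Icc).mono_set fun t ht => ⟨ha.trans ht.1.le, ht.2.le.trans hb⟩)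
    (((hc₂.pow 2).integrableOn_Icc).mono_set fun t ht => ⟨ha.trans ht.1.le, ht.2.le.trans hb⟩)
    (((hc₁.mul hc₂).integrableOn_Icc).mono_set
      fun t ht => ⟨ha.trans ht.1.le, ht.2.le.trans hb⟩)
  refine hmink.trans ?_
  have hs : 0 < (M : ℝ) * σ ^ 2 / N := by positivity
  have hd : 0 < (M : ℝ)⁻¹ := by positivity
  have hgap0 : 0 < (q : ℝ) - p := lt_of_lt_of_le (by positivity) hgap
  have hε₁ : 128 * ((M : ℝ)⁻¹) ^ 2 ≤ (((q : ℝ) - p) * (M : ℝ)⁻¹) ^ 2 := by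
    rw [mul_pow]
    gcongr
    calc (128 : ℝ) = (2 * √32) ^ 2 := by rw [mul_pow, Real.sq_sqrt (by norm_num)]; norm_num
      _ ≤ _ := by gcongr
  have hsσ : √((M : ℝ) * σ ^ 2 / N) ≤ (max √σ (((q : ℝ) - p) * (M : ℝ)⁻¹)) ^ 2 := by
    calc √((M : ℝ) * σ ^ 2 / N) ≤ √(σ ^ 2) := by
          apply Real.sqrt_le_sqrt
          rw [div_le_iff₀ hN0, mul_comm]
          gcongr
      _ = √σ ^ 2 := by rw [Real.sqrt_sq hσ.le, Real.sq_sqrt hσ.le]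
      _ ≤ _ := by
        gcongr
        exact le_max_left _ _
  have hB₁ := sobolev_absorption (a := F ^ 2) (b := ((9 / 8) * β + 1) * F ^ 2) hd hs hγ hK hC₁
    (by positivity) (hmse₁.trans (by apply le_of_eq; ring)) (by positivity) (by positivity) hA₁ hε₁
    (by positivity) hsobolev₁ hsσ (le_max_right _ _) hsobolevK₁
  have hB₂ := sobolev_absorption (a := 4 / δ) (b := 0) hd hs hγ hK hC₂
    (by positivity) (hmse₂.trans (by apply le_of_eq; field_simp; ring)) le_rfl (by positivity)
    hA₂ hε₁ (by positivity) hsobolev₂ hsσ (le_max_right _ _) hsobolevK₂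
  have hsB₁ := (Real.sqrt_le_sqrt (hB₁.trans_eq (by field_simp; ring))).trans
    (sqrt_mul_sq_add_le (P := 4 / γ + (9 / 4) * β + 4)
      (Q := (9 * β + 8) / (8 * 32 * γ) + 18 * 32 * β + 32 * 32) hK.le hF (by positivity)
      (by positivity) (Real.sqrt_nonneg ((M : ℝ) * σ ^ 2 / N)) hd.le)
  have hδ' : (1 / √δ) ^ 2 = 1 / δ := by rw [div_pow, Real.sq_sqrt hδ₀.le, one_pow]
  have hsB₂ := (Real.sqrt_le_sqrt (hB₂.trans_eq (by rw [hδ']; field_simp; ring))).trans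
    (sqrt_mul_sq_add_le (F := 1 / √δ) (P := 16 / γ + 1) (Q := 8 * 32) hK.le (by positivity)
      (by positivity) (by positivity) (Real.sqrt_nonneg ((M : ℝ) * σ ^ 2 / N)) hd.le)
  have h256 : √(8 * 32 : ℝ) = 2 * √2 * √32 := by
    rw [Real.sqrt_mul (by norm_num), show (8 : ℝ) = 2 ^ 2 * 2 by norm_num,
      Real.sqrt_mul (by norm_num), Real.sqrt_sq (by norm_num)]
  rw [h256] at hsB₂
  refine (add_le_add hsB₁ hsB₂).trans_eq ?_
  ring
end
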